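/- arXiv:1207.0638 — 2 statements merged into one kernel-verified Lean document; each statement's English description precedes it below -/
import Mathlib

section
/- Let X be a finite abstract simplicial complex of dimension d on n vertices with a complete skeleton. Then the lower Laplacian satisfies Δ− = n·P_{B^{d-1}}, where P_{B^{d-1}} is the orthogonal projection of Ω^{d-1} onto B^{d-1} = im ∂*_{d-1}. -/
open Finset

/-- A finite abstract simplicial complex on the vertex type `V`: a collection of finite
subsets of `V` (the cells), closed under taking subsets and containing the empty cell. -/
structure SComplex (V : Type) [Fintype V] [DecidableEq V] : Type where
  cells : Finset (Finset V)
  empty_mem : ∅ ∈ cells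
  down_closed : ∀ s ∈ cells, ∀ t ⊆ s, t ∈ cells

namespace SComplex

variable {V : Type} [Fintype V] [DecidableEq V]

/-- The cells of `X` with exactly `m` vertices, i.e. the `(m-1)`-dimensional cells `X^{m-1}`. -/
def cellsCard (X : SComplex V) (m : ℕ) : Finset (Finset V) :=
  X.cells.filter fun s => s.card = m

/-- `X` is `D`-dimensional: every cell has at most `D+1` vertices and some cell has
exactly `D+1` vertices. -/
def Dim (X : SComplex V) (D : ℕ) : Prop :=
  (∀ s ∈ X.cells, s.card ≤ D + 1) ∧ ∃ s ∈ X.cells, s.card = D + 1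

/-- `X` (of dimension `D`) has a complete skeleton: every subset of `V` with at most `D`
elements is a cell. -/
def CompleteSkeleton (X : SComplex V) (D : ℕ) : Prop :=
  ∀ s : Finset V, s.card ≤ D → s ∈ X.cells

/-- The set of vertices of an ordered tuple. -/
def tset {m : ℕ} (σ : Fin m → V) : Finset V := Finset.image σ Finset.univ

/-- An ordered tuple of vertices is an oriented cell when it is injective and its vertex
set is a cell of `X`. -/
def IsCell (X : SComplex V) {m : ℕ} (σ : Fin m → V) : Prop :=
  Function.Injective σ ∧ tset σ ∈ X.cells

instance (X : SComplex V) {m : ℕ} (σ : Fin m → V) : Decidable (X.IsCell σ) := by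
  unfold IsCell; infer_instance

/-- `X.nbr v σ` : the vertex `v` does not belong to `σ` and together with `σ` spans a
cell of `X`. -/
def nbr (X : SComplex V) {m : ℕ} (v : V) (σ : Fin m → V) : Prop :=
  v ∉ tset σ ∧ insert v (tset σ) ∈ X.cells

instance (X : SComplex V) {m : ℕ} (v : V) (σ : Fin m → V) : Decidable (X.nbr v σ) := by
  unfold nbr; infer_instance

/-- `f` is an `(m-1)`-form on `X`: a function on ordered tuples of `m` vertices which is
skew-symmetric with respect to permutations of the tuple, and is supported on the
oriented `(m-1)`-cells of `X`. -/
def IsForm (X : SComplex V) (m : ℕ) (f : (Fin m → V) → ℝ) : Prop :=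
  (∀ (σ : Fin m → V) (π : Equiv.Perm (Fin m)),
      f (σ ∘ π) = ((Equiv.Perm.sign π : ℤ) : ℝ) * f σ) ∧
  ∀ σ : Fin m → V, ¬ X.IsCell σ → f σ = 0

/-- The space `Ω^{m-1}(X)` of `(m-1)`-forms, as a submodule of the functions on tuples. -/
def formSub (X : SComplex V) (m : ℕ) : Submodule ℝ ((Fin m → V) → ℝ) where
  carrier := {f | X.IsForm m f}
  add_mem' := @fun f g hf hg => ⟨fun σ π => by
      simp only [Pi.add_apply, hf.1 σ π, hg.1 σ π]; ring,
    fun σ h => by simp only [Pi.add_apply, hf.2 σ h, hg.2 σ h, add_zero]⟩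
  zero_mem' := ⟨fun σ π => by simp, fun σ h => rfl⟩
  smul_mem' := @fun c f hf => ⟨fun σ π => by
      simp only [Pi.smul_apply, smul_eq_mul, hf.1 σ π]; ring,
    fun σ h => by simp only [Pi.smul_apply, hf.2 σ h, smul_eq_mul, mul_zero]⟩

/-- The inner product `⟨f,g⟩ = ∑_{σ ∈ X^{m-1}} f(σ) g(σ)` on `(m-1)`-forms, computed via
ordered tuples (each cell is counted `m!` times, once for each ordering of its vertices). -/
noncomputable def innerForm (m : ℕ) (f g : (Fin m → V) → ℝ) : ℝ :=
  ((m.factorial : ℝ))⁻¹ * ∑ σ : Fin m → V, f σ * g σ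

/-- The boundary operator `∂ : Ω^m → Ω^{m-1}`, `(∂f)(σ) = ∑_{v ∼ σ} f(vσ)`. -/
def bdry (X : SComplex V) (m : ℕ) (f : (Fin (m+1) → V) → ℝ) : (Fin m → V) → ℝ :=
  fun σ => ∑ v : V, if X.nbr v σ then f (Fin.cons v σ) else 0

/-- The coboundary operator `∂* : Ω^{m-1} → Ω^m`, `(∂*f)(σ) = ∑ i (-1)^i f(σ ∖ σᵢ)`,
supported on the oriented `m`-cells of `X`. -/
def cobdry (X : SComplex V) (m : ℕ) (f : (Fin m → V) → ℝ) : (Fin (m+1) → V) → ℝ :=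
  fun σ => if X.IsCell σ then ∑ i : Fin (m+1), (-1 : ℝ) ^ (i : ℕ) * f (σ ∘ i.succAbove) else 0

/-- The upper Laplacian `Δ⁺ = ∂ ∘ ∂*` on `(m-1)`-forms. -/
def upLap (X : SComplex V) (m : ℕ) (f : (Fin m → V) → ℝ) : (Fin m → V) → ℝ :=
  X.bdry m (X.cobdry m f)

/-- The lower Laplacian `Δ⁻ = ∂* ∘ ∂` on `m`-forms. -/
def lowLap (X : SComplex V) (m : ℕ) (f : (Fin (m+1) → V) → ℝ) : (Fin (m+1) → V) → ℝ :=
  X.cobdry m (X.bdry m f)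

/-- The boundary operator as a linear map. -/
def bdryL (X : SComplex V) (m : ℕ) : ((Fin (m+1) → V) → ℝ) →ₗ[ℝ] ((Fin m → V) → ℝ) where
  toFun := X.bdry m
  map_add' f g := by
    funext σ
    show (∑ v : V, if X.nbr v σ then (f + g) (Fin.cons v σ) else 0) =
      (∑ v : V, if X.nbr v σ then f (Fin.cons v σ) else 0) +
      (∑ v : V, if X.nbr v σ then g (Fin.cons v σ) else 0)
    rw [← Finset.sum_add_distrib]
    exact Finset.sum_congr rfl fun v _ => by by_cases h : X.nbr v σ <;> simp [h]
  map_smul' c f := by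
    funext σ
    show (∑ v : V, if X.nbr v σ then (c • f) (Fin.cons v σ) else 0) =
      c * (∑ v : V, if X.nbr v σ then f (Fin.cons v σ) else 0)
    rw [Finset.mul_sum]
    exact Finset.sum_congr rfl fun v _ => by by_cases h : X.nbr v σ <;> simp [h]

/-- The coboundary operator as a linear map. -/
def cobdryL (X : SComplex V) (m : ℕ) : ((Fin m → V) → ℝ) →ₗ[ℝ] ((Fin (m+1) → V) → ℝ) where
  toFun := X.cobdry m
  map_add' f g := by
    funext σ
    show X.cobdry m (f + g) σ = X.cobdry m f σ + X.cobdry m g σ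
    unfold cobdry
    by_cases h : X.IsCell σ
    · simp only [h, if_true, ← Finset.sum_add_distrib]
      exact Finset.sum_congr rfl fun i _ => by simp [Pi.add_apply]; ring
    · simp [h]
  map_smul' c f := by
    funext σ
    show X.cobdry m (c • f) σ = c * X.cobdry m f σ
    unfold cobdry
    by_cases h : X.IsCell σ
    · simp only [h, if_true, Finset.mul_sum]
      exact Finset.sum_congr rfl fun i _ => by simp [Pi.smul_apply]; ring
    · simp [h]

/-- The degree of a cell `s`: the number of cells with one more vertex containing `s`. -/
def degCell (X : SComplex V) (s : Finset V) : ℕ :=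
  (X.cells.filter fun t => s ⊆ t ∧ t.card = s.card + 1).card

/-- The maximal degree of an `(m-1)`-cell of `X`. -/
def maxDeg (X : SComplex V) (m : ℕ) : ℕ :=
  (X.cellsCard m).sup fun s => X.degCell s

/-- The spectrum of the upper Laplacian of a `(d+1)`-dimensional complex restricted to
the cycle space `Z = ker ∂` inside the space of forms on `d+1` vertices. -/
def specUpLapZ (X : SComplex V) (d : ℕ) : Set ℝ :=
  {μ | ∃ f : (Fin (d+1) → V) → ℝ,
    X.IsForm (d+1) f ∧ X.bdry d f = 0 ∧ f ≠ 0 ∧ X.upLap (d+1) f = μ • f}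

/-- The spectral gap `λ(X) = min Spec (Δ⁺|_Z)` of a `(d+1)`-dimensional complex. -/
noncomputable def spectralGap (X : SComplex V) (d : ℕ) : ℝ :=
  sInf (X.specUpLapZ d)

/-- `F(A 0, …, A (m-1))`: the set of cells with `m` vertices having exactly one vertex
in each `A i`. -/
def Fcells (X : SComplex V) {m : ℕ} (A : Fin m → Finset V) : Finset (Finset V) :=
  X.cells.filter fun s => s.card = m ∧ ∀ i, (s ∩ A i).card = 1

/-- The Cheeger constant of a `(d+1)`-dimensional complex: the minimum over all
partitions of the vertex set into `d+2` nonempty parts of `n·|F(A₀,…)|/∏|Aᵢ|`. -/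
noncomputable def cheeger (X : SComplex V) (d : ℕ) : ℝ :=
  sInf { r : ℝ | ∃ A : Fin (d+2) → Finset V,
    (∀ i, (A i).Nonempty) ∧ (∀ i j, i ≠ j → Disjoint (A i) (A j)) ∧
    Finset.univ.biUnion A = Finset.univ ∧
    r = (Fintype.card V : ℝ) * ((X.Fcells A).card : ℝ) / ∏ i, ((A i).card : ℝ) }

/-- The `m`-th reduced Betti number `β_m = dim H_m` of `X` over `ℝ`:
`dim (Ω^m ∩ ker ∂_m) - dim (∂_{m+1} Ω^{m+1})`. -/
noncomputable def betti (X : SComplex V) (m : ℕ) : ℕ :=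
  Module.finrank ℝ ↥(X.formSub (m+1) ⊓ LinearMap.ker (X.bdryL m)) -
  Module.finrank ℝ ↥(Submodule.map (X.bdryL (m+1)) (X.formSub (m+2)))

/-- The vertices of the link of `τ`. -/
def linkVerts (X : SComplex V) (τ : Finset V) : Finset V :=
  Finset.univ.filter fun v => v ∉ τ ∧ insert v τ ∈ X.cells

/-- The neighbours of `v` in the link graph of `τ`. -/
def linkNbrs (X : SComplex V) (τ : Finset V) (v : V) : Finset V :=
  Finset.univ.filter fun w => w ≠ v ∧ w ∉ τ ∧ v ∉ τ ∧ insert v (insert w τ) ∈ X.cells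

/-- The graph Laplacian of the link of `τ`. -/
def linkLap (X : SComplex V) (τ : Finset V) (g : V → ℝ) : V → ℝ :=
  fun v => ((X.linkNbrs τ v).card : ℝ) * g v - ∑ w ∈ X.linkNbrs τ v, g w

/-- The graph spectral gap of the link of `τ`: the minimal eigenvalue of its graph
Laplacian on functions on its vertices summing to zero. -/
noncomputable def linkGap (X : SComplex V) (τ : Finset V) : ℝ :=
  sInf {μ : ℝ | ∃ g : V → ℝ, (∀ v, v ∉ X.linkVerts τ → g v = 0) ∧
    (∑ v ∈ X.linkVerts τ, g v = 0) ∧ g ≠ 0 ∧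
    ∀ v ∈ X.linkVerts τ, X.linkLap τ g v = μ * g v}

/-- The graph Cheeger constant of the link of `τ`: the minimum over partitions
`B ⊔ C` of its vertex set of `|W|·|E(B,C)|/(|B|·|C|)`. -/
noncomputable def linkCheeger (X : SComplex V) (τ : Finset V) : ℝ :=
  sInf { r : ℝ | ∃ B C : Finset V, B.Nonempty ∧ C.Nonempty ∧ Disjoint B C ∧
    B ∪ C = X.linkVerts τ ∧
    r = ((X.linkVerts τ).card : ℝ) *
        (((B ×ˢ C).filter fun p => insert p.1 (insert p.2 τ) ∈ X.cells).card : ℝ) /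
        ((B.card : ℝ) * (C.card : ℝ)) }

/-- `deg_τ(s)`: the number of neighbours `s'` of the cell `s` which contain `τ` (two
distinct cells with the same number of vertices are neighbours when their union is a
cell of `X` with one more vertex). -/
def degTau (X : SComplex V) (τ s : Finset V) : ℕ :=
  (X.cells.filter fun s' => s'.card = s.card ∧ s' ≠ s ∧ τ ⊆ s' ∧
    (s ∪ s').card = s.card + 1 ∧ s ∪ s' ∈ X.cells).card

/-- The local upper Laplacian `Δ⁺_τ` associated to a cell `τ` with `d` vertices of a
`(d+1)`-dimensional complex, acting on forms on `d+1` vertices: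
`(Δ⁺_τ f)(σ) = deg_τ(σ) f(σ) - ∑_{σ' ∼ σ, τ ⊆ σ'} f(σ')` when `τ ⊆ σ`, and `0` else. -/
def localUpLap (X : SComplex V) (d : ℕ) (τ : Finset V) (f : (Fin (d+1) → V) → ℝ) :
    (Fin (d+1) → V) → ℝ :=
  fun σ => if τ ⊆ tset σ then
      (X.degTau τ (tset σ) : ℝ) * f σ -
        ∑ v : V, if X.nbr v σ then
          ∑ i : Fin (d+1), if σ i ∉ τ then
            (-1 : ℝ) ^ (i : ℕ) * f (Fin.cons v σ ∘ Fin.succAbove i.succ) else 0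
        else 0
    else 0

/-- The complement complex `X̄` of a `D`-dimensional complex `X` with complete skeleton:
it has the same cells of dimension `< D`, and its `D`-dimensional cells are exactly the
vertex sets of size `D+1` which are not cells of `X`. -/
def complComplex (X : SComplex V) (D : ℕ) (hX : X.CompleteSkeleton D) : SComplex V where
  cells := (X.cells.filter fun s => s.card ≤ D) ∪
    ((Finset.univ : Finset V).powersetCard (D+1)).filter fun s => s ∉ X.cells
  empty_mem := Finset.mem_union_left _ (Finset.mem_filter.mpr ⟨X.empty_mem, by simp⟩)
  down_closed := by
    intro s hs t ht
    rcases Finset.mem_union.mp hs with h | h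
    · rw [Finset.mem_filter] at h
      exact Finset.mem_union_left _ (Finset.mem_filter.mpr
        ⟨X.down_closed s h.1 t ht, le_trans (Finset.card_le_card ht) h.2⟩)
    · rw [Finset.mem_filter, Finset.mem_powersetCard] at h
      by_cases hts : t = s
      · subst hts
        exact Finset.mem_union_right _ (Finset.mem_filter.mpr
          ⟨Finset.mem_powersetCard.mpr h.1, h.2⟩)
      · have hlt : t.card < s.card := Finset.card_lt_card (ht.ssubset_of_ne hts)
        have hsD : s.card = D + 1 := h.1.2
        have htD : t.card ≤ D := by omega
        exact Finset.mem_union_left _ (Finset.mem_filter.mpr ⟨hX t htD, htD⟩)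

/-- The simplicial complex on `V` with complete `(d+1)`-dimensional skeleton whose
top-dimensional cells (with `d+2` vertices) are the members of `T`: the Linial–Meshulam
complex determined by the sample `T`. -/
def lmComplex (V : Type) [Fintype V] [DecidableEq V] (d : ℕ) (T : Finset (Finset V)) :
    SComplex V where
  cells := (Finset.univ.powerset.filter fun s : Finset V => s.card ≤ d + 1) ∪
    T.filter fun s => s.card = d + 2
  empty_mem := Finset.mem_union_left _ (by simp)
  down_closed := by
    intro s hs t ht
    rcases Finset.mem_union.mp hs with h | h
    · rw [Finset.mem_filter] at h
      exact Finset.mem_union_left _ (Finset.mem_filter.mpr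
        ⟨Finset.mem_powerset.mpr (Finset.subset_univ t), le_trans (Finset.card_le_card ht) h.2⟩)
    · rw [Finset.mem_filter] at h
      by_cases hts : t = s
      · subst hts; exact Finset.mem_union_right _ (Finset.mem_filter.mpr h)
      · have hlt : t.card < s.card := Finset.card_lt_card (ht.ssubset_of_ne hts)
        have hsd : s.card = d + 2 := h.2
        have htd : t.card ≤ d + 1 := by omega
        exact Finset.mem_union_left _ (Finset.mem_filter.mpr
          ⟨Finset.mem_powerset.mpr (Finset.subset_univ t), htd⟩)

open Classical in
/-- The probability, under the Linial–Meshulam measure `X(d+1, n, p)` (each possible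
top-dimensional cell on `d+2` vertices is included independently with probability `p`),
of an event `E` depending on the set of top-dimensional cells. -/
noncomputable def lmProb (V : Type) [Fintype V] [DecidableEq V] (d : ℕ) (p : ℝ)
    (E : Finset (Finset V) → Prop) : ℝ :=
  ∑ T ∈ ((Finset.univ : Finset V).powersetCard (d+2)).powerset,
    if E T then
      p ^ T.card * (1 - p) ^ (((Finset.univ : Finset V).powersetCard (d+2)).card - T.card)
    else 0

end SComplex

namespace SComplex

variable {V : Type} [Fintype V] [DecidableEq V]

/-- A permutation intertwines the face inclusions `i.succAbove` and `(π i).succAbove` up to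
a permutation of the smaller index set. -/
theorem exists_perm_comp_succAbove {m : ℕ} (π : Equiv.Perm (Fin (m + 1))) (i : Fin (m + 1)) :
    ∃ e : Equiv.Perm (Fin m), (∀ j, π (i.succAbove j) = (π i).succAbove (e j)) ∧
      ((Equiv.Perm.sign e : ℤ) : ℝ) =
        (-1) ^ (i : ℕ) * (-1) ^ (π i : ℕ) * ((Equiv.Perm.sign π : ℤ) : ℝ) := by
  obtain ⟨⟨p, e⟩, hQ⟩ : ∃ q, Equiv.Perm.decomposeFin.symm q =
      (π i).cycleRange * π * (i.cycleRange)⁻¹ := Equiv.Perm.decomposeFin.symm.surjective _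
  have hp : p = 0 := by
    have h := congrArg (fun s : Equiv.Perm (Fin (m + 1)) => s 0) hQ
    simpa [Equiv.Perm.inv_def] using h
  subst hp
  refine ⟨e, fun j => ?_, ?_⟩
  · have h := congrArg (fun s : Equiv.Perm (Fin (m + 1)) => s j.succ) hQ
    simp only [Equiv.Perm.decomposeFin_symm_apply_succ, Equiv.swap_self, Equiv.refl_apply,
      Equiv.Perm.mul_apply, Equiv.Perm.inv_def, Fin.cycleRange_symm_succ] at h
    rw [← Fin.cycleRange_symm_succ (π i), h, Equiv.symm_apply_apply]
  · have h := congrArg (fun s => ((Equiv.Perm.sign s : ℤ) : ℝ)) hQ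
    simp only [Equiv.Perm.decomposeFin.symm_sign, if_true, one_mul, Equiv.Perm.sign_mul,
      Equiv.Perm.sign_inv, Fin.sign_cycleRange] at h
    rw [h]
    push_cast
    ring

theorem cons_comp_perm {α : Type*} {m : ℕ} (v : α) (τ : Fin m → α) (π : Equiv.Perm (Fin m)) :
    (Fin.cons v (τ ∘ π) : Fin (m + 1) → α) =
      Fin.cons v τ ∘ Equiv.Perm.decomposeFin.symm (0, π) := by
  funext j
  refine Fin.cases ?_ (fun j => ?_) j <;> simp

theorem insertNth_eq_cons_comp {α : Type*} {m : ℕ} (i : Fin (m + 1)) (v : α)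
    (τ : Fin m → α) : (i.insertNth v τ : Fin (m + 1) → α) = Fin.cons v τ ∘ i.cycleRange := by
  funext j
  refine Fin.succAboveCases i ?_ (fun j => ?_) j <;> simp

theorem tset_cons {α : Type} [DecidableEq α] {m : ℕ} (v : α) (τ : Fin m → α) :
    tset (Fin.cons v τ : Fin (m + 1) → α) = insert v (tset τ) := by
  ext x
  simp [tset, Fin.exists_fin_succ, eq_comm]

theorem tset_comp_perm {α : Type} [DecidableEq α] {m : ℕ} (σ : Fin m → α)
    (π : Equiv.Perm (Fin m)) :
    tset (σ ∘ π) = tset σ := by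
  ext x
  simp only [tset, mem_image, mem_univ, true_and, Function.comp_apply]
  exact π.surjective.exists (p := fun a => σ a = x) |>.symm

theorem isCell_comp_perm {X : SComplex V} {m : ℕ} (σ : Fin m → V) (π : Equiv.Perm (Fin m)) :
    X.IsCell (σ ∘ π) ↔ X.IsCell σ := by
  simp [IsCell, tset_comp_perm]

theorem IsCell.of_cons {X : SComplex V} {m : ℕ} {v : V} {τ : Fin m → V}
    (h : X.IsCell (Fin.cons v τ : Fin (m + 1) → V)) : X.IsCell τ ∧ X.nbr v τ := by
  obtain ⟨hi, hc⟩ := h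
  rw [tset_cons] at hc
  rw [Fin.cons_injective_iff] at hi
  exact ⟨⟨hi.2, X.down_closed _ hc _ (subset_insert _ _)⟩, by simpa [tset] using hi.1, hc⟩

/-- In a complex with complete skeleton, the oriented cells of dimension less than the top one
are exactly the injective tuples. -/
theorem CompleteSkeleton.isCell {X : SComplex V} {D m : ℕ} (hX : X.CompleteSkeleton D)
    (hm : m ≤ D) {σ : Fin m → V} (hσ : Function.Injective σ) : X.IsCell σ :=
  ⟨hσ, hX _ ((card_image_le).trans (by simpa using hm))⟩

theorem bdry_apply {X : SComplex V} {m : ℕ} {f : (Fin (m + 1) → V) → ℝ}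
    (hf : X.IsForm (m + 1) f) (τ : Fin m → V) :
    X.bdry m f τ = ∑ v : V, f (Fin.cons v τ) :=
  Finset.sum_congr rfl fun v _ => by
    split_ifs with h
    · rfl
    · exact (hf.2 _ fun hc => h hc.of_cons.2).symm

theorem IsForm.bdry {X : SComplex V} {m : ℕ} {f : (Fin (m + 1) → V) → ℝ}
    (hf : X.IsForm (m + 1) f) : X.IsForm m (X.bdry m f) := by
  refine ⟨fun τ π => ?_, fun τ hτ => ?_⟩
  · rw [bdry_apply hf, bdry_apply hf, mul_sum]
    refine sum_congr rfl fun v _ => ?_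
    rw [cons_comp_perm, hf.1]
    simp
  · rw [bdry_apply hf]
    exact sum_eq_zero fun v _ => hf.2 _ fun hc => hτ hc.of_cons.1

/-- The alternating sum of a skew-symmetric function over the faces of a tuple is
skew-symmetric. -/
theorem IsForm.sum_faces_comp_perm {X : SComplex V} {m : ℕ} {h : (Fin m → V) → ℝ}
    (hh : X.IsForm m h) (σ : Fin (m + 1) → V) (π : Equiv.Perm (Fin (m + 1))) :
    ∑ i : Fin (m + 1), (-1 : ℝ) ^ (i : ℕ) * h ((σ ∘ π) ∘ i.succAbove) =
      ((Equiv.Perm.sign π : ℤ) : ℝ) *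
        ∑ i : Fin (m + 1), (-1 : ℝ) ^ (i : ℕ) * h (σ ∘ i.succAbove) := by
  rw [← Equiv.sum_comp π (fun i => (-1 : ℝ) ^ (i : ℕ) * h (σ ∘ i.succAbove)), mul_sum]
  refine sum_congr rfl fun i _ => ?_
  obtain ⟨e, he, hs⟩ := exists_perm_comp_succAbove π i
  have hcomp : (σ ∘ π) ∘ i.succAbove = (σ ∘ (π i).succAbove) ∘ e :=
    funext fun j => congrArg σ (he j)
  rw [hcomp, hh.1, hs]
  have hsq : ((-1 : ℝ) ^ (i : ℕ)) * (-1) ^ (i : ℕ) = 1 := by rw [← mul_pow]; simp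
  linear_combination (-1 : ℝ) ^ (π i : ℕ) * ((Equiv.Perm.sign π : ℤ) : ℝ) *
    h (σ ∘ (π i).succAbove) * hsq

theorem IsForm.cobdry {X : SComplex V} {m : ℕ} {h : (Fin m → V) → ℝ}
    (hh : X.IsForm m h) : X.IsForm (m + 1) (X.cobdry m h) := by
  refine ⟨fun σ π => ?_, fun σ hσ => if_neg hσ⟩
  unfold SComplex.cobdry
  simp only [isCell_comp_perm, hh.sum_faces_comp_perm, mul_ite, mul_zero]

theorem IsForm.apply_insertNth {X : SComplex V} {m : ℕ} {f : (Fin (m + 1) → V) → ℝ}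
    (hf : X.IsForm (m + 1) f) (i : Fin (m + 1)) (v : V) (τ : Fin m → V) :
    f (i.insertNth v τ) = (-1) ^ (i : ℕ) * f (Fin.cons v τ) := by
  rw [insertNth_eq_cons_comp, hf.1, Fin.sign_cycleRange]
  simp

/-- The boundary and coboundary operators are adjoint to each other. -/
theorem innerForm_cobdry {X : SComplex V} {m : ℕ} {f : (Fin (m + 1) → V) → ℝ}
    (hf : X.IsForm (m + 1) f) (h : (Fin m → V) → ℝ) :
    innerForm (m + 1) f (X.cobdry m h) = innerForm m (X.bdry m f) h := by
  have key : ∑ σ, f σ * X.cobdry m h σ = (m + 1) * ∑ τ, X.bdry m f τ * h τ := by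
    calc ∑ σ, f σ * X.cobdry m h σ
        = ∑ σ, ∑ i : Fin (m + 1), (-1) ^ (i : ℕ) * f σ * h (σ ∘ i.succAbove) := by
          refine sum_congr rfl fun σ _ => ?_
          unfold SComplex.cobdry
          split_ifs with hσ
          · rw [mul_sum]
            exact sum_congr rfl fun i _ => by ring
          · simp [hf.2 σ hσ]
      _ = ∑ i : Fin (m + 1), ∑ τ : Fin m → V, X.bdry m f τ * h τ := by
          rw [sum_comm]
          refine sum_congr rfl fun i _ => ?_
          rw [← Equiv.sum_comp (Fin.insertNthEquiv (fun _ => V) i), Fintype.sum_prod_type,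
            sum_comm]
          refine sum_congr rfl fun τ _ => ?_
          rw [bdry_apply hf, sum_mul]
          refine sum_congr rfl fun v _ => ?_
          have hτ : (i.insertNth v τ : Fin (m + 1) → V) ∘ i.succAbove = τ :=
            funext fun j => by simp
          have hsq : ((-1 : ℝ) ^ (i : ℕ)) * (-1) ^ (i : ℕ) = 1 := by rw [← mul_pow]; simp
          change (-1) ^ (i : ℕ) * f (i.insertNth v τ) *
            h ((i.insertNth v τ : Fin (m + 1) → V) ∘ i.succAbove) = f (Fin.cons v τ) * h τ
          rw [hτ, hf.apply_insertNth]
          linear_combination f (Fin.cons v τ) * h τ * hsq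
      _ = _ := by simp
  have hm : (m.factorial : ℝ) ≠ 0 := by positivity
  have hm' : (m : ℝ) + 1 ≠ 0 := by positivity
  rw [innerForm, innerForm, key, Nat.factorial_succ]
  push_cast
  field_simp

theorem bdry_bdry {X : SComplex V} {m : ℕ} {f : (Fin (m + 2) → V) → ℝ}
    (hf : X.IsForm (m + 2) f) : X.bdry m (X.bdry (m + 1) f) = 0 := by
  funext ρ
  have hswap (v w : V) : f (Fin.cons w (Fin.cons v ρ)) = -f (Fin.cons v (Fin.cons w ρ)) := by
    have hcomp : (Fin.cons w (Fin.cons v ρ : Fin (m + 1) → V) : Fin (m + 2) → V) =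
        Fin.cons v (Fin.cons w ρ : Fin (m + 1) → V) ∘ Equiv.swap 0 1 := by
      funext j
      refine Fin.cases (by simp) (fun j => Fin.cases (by simp) (fun j => ?_) j) j
      rw [Function.comp_apply, Equiv.swap_apply_of_ne_of_ne (Fin.succ_ne_zero _)
        (by
          rw [← Fin.succ_zero_eq_one]
          exact fun h => Fin.succ_ne_zero j (Fin.succ_injective _ h))]
      simp
    rw [hcomp, hf.1, Equiv.Perm.sign_swap (by simp)]
    simp
  have hsum : X.bdry m (X.bdry (m + 1) f) ρ =
      ∑ v : V, ∑ w : V, f (Fin.cons w (Fin.cons v ρ)) := by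
    rw [bdry_apply hf.bdry]
    exact sum_congr rfl fun v _ => bdry_apply hf _
  have hneg : X.bdry m (X.bdry (m + 1) f) ρ = -X.bdry m (X.bdry (m + 1) f) ρ := by
    conv_lhs => rw [hsum, sum_comm]
    rw [hsum, ← sum_neg_distrib]
    refine sum_congr rfl fun v _ => ?_
    rw [← sum_neg_distrib]
    exact sum_congr rfl fun w _ => hswap w v
  simp only [Pi.zero_apply]
  linarith

/-- The alternating sum of a form over the faces of a tuple with a repeated vertex vanishes. -/
theorem IsForm.sum_faces_eq_zero {X : SComplex V} {m : ℕ} {h : (Fin m → V) → ℝ}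
    (hh : X.IsForm m h) {σ : Fin (m + 1) → V} (hσ : ¬ Function.Injective σ) :
    ∑ i : Fin (m + 1), (-1 : ℝ) ^ (i : ℕ) * h (σ ∘ i.succAbove) = 0 := by
  obtain ⟨a, b, hab, hne⟩ := Function.not_injective_iff.mp hσ
  have hcomp : σ ∘ Equiv.swap a b = σ := by
    funext j
    rw [Function.comp_apply, Equiv.swap_apply_def]
    split_ifs <;> simp_all
  have hneg := hh.sum_faces_comp_perm σ (Equiv.swap a b)
  rw [hcomp, Equiv.Perm.sign_swap hne] at hneg
  push_cast at hneg
  linarith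

theorem CompleteSkeleton.cobdry_apply {X : SComplex V} {D m : ℕ} (hX : X.CompleteSkeleton D)
    (hm : m + 1 ≤ D) {h : (Fin m → V) → ℝ} (hh : X.IsForm m h) (σ : Fin (m + 1) → V) :
    X.cobdry m h σ = ∑ i : Fin (m + 1), (-1 : ℝ) ^ (i : ℕ) * h (σ ∘ i.succAbove) := by
  unfold SComplex.cobdry
  split_ifs with hσ
  · rfl
  · exact (hh.sum_faces_eq_zero fun hi => hσ (hX.isCell hm hi)).symm

/-- On boundaries, the upper Laplacian of a complete skeleton is multiplication by the number
of vertices. -/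
theorem CompleteSkeleton.upLap_bdry {X : SComplex V} {D m : ℕ} (hX : X.CompleteSkeleton D)
    (hm : m + 1 ≤ D) {f : (Fin (m + 1) → V) → ℝ} (hf : X.IsForm (m + 1) f) :
    X.upLap m (X.bdry m f) = (Fintype.card V : ℝ) • X.bdry m f := by
  funext τ
  have hface (j : Fin m) :
      ∑ v : V, X.bdry m f ((Fin.cons v τ : Fin (m + 1) → V) ∘ j.succ.succAbove) = 0 := by
    cases m with
    | zero => exact j.elim0
    | succ k =>
      have hcomp (v : V) : (Fin.cons v τ : Fin (k + 2) → V) ∘ j.succ.succAbove =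
          Fin.cons v (τ ∘ j.succAbove) := by
        funext l
        refine Fin.cases ?_ (fun l => ?_) l <;> simp
      simp only [hcomp]
      rw [← bdry_apply hf.bdry, bdry_bdry hf, Pi.zero_apply]
  have hzero (v : V) : (Fin.cons v τ : Fin (m + 1) → V) ∘ (0 : Fin (m + 1)).succAbove = τ := by
    funext l
    simp
  rw [upLap, bdry_apply hf.bdry.cobdry]
  simp only [hX.cobdry_apply hm hf.bdry]
  rw [sum_comm, Fin.sum_univ_succ]
  simp only [← mul_sum, hface, hzero]
  simp

end SComplex

open SComplex in
/-- Proposition 3.2(3): for a `(d+1)`-dimensional complex `X` with complete skeleton on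
`n` vertices, the lower Laplacian satisfies `Δ⁻ = n·P_{B}` where `P_B` is the orthogonal
projection onto `B = im ∂*` (i.e. for each form `f` there is `g ∈ B` with `f - g ⊥ B`
and `Δ⁻ f = n·g`). -/
theorem lowLap_eq_proj (V : Type) [Fintype V] [DecidableEq V] (d : ℕ)
    (X : SComplex V) (hdim : X.Dim (d + 1)) (hskel : X.CompleteSkeleton (d + 1))
    (f : (Fin (d + 1) → V) → ℝ) (hf : X.IsForm (d + 1) f) :
    ∃ g : (Fin (d + 1) → V) → ℝ,
      g ∈ Submodule.map (X.cobdryL d) (X.formSub d) ∧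
      (∀ h ∈ Submodule.map (X.cobdryL d) (X.formSub d),
        SComplex.innerForm (d + 1) (f - g) h = 0) ∧
      X.lowLap d f = (Fintype.card V : ℝ) • g := by
  have hn : (Fintype.card V : ℝ) ≠ 0 := by
    obtain ⟨s, -, hs⟩ := hdim.2
    have : s.card ≤ Fintype.card V := s.card_le_univ
    exact_mod_cast (by omega : Fintype.card V ≠ 0)
  set g : (Fin (d + 1) → V) → ℝ := (Fintype.card V : ℝ)⁻¹ • X.lowLap d f with hg
  have hlow : X.lowLap d f ∈ Submodule.map (X.cobdryL d) (X.formSub d) :=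
    Submodule.mem_map_of_mem (p := X.formSub d) (f := X.cobdryL d) hf.bdry
  refine ⟨g, Submodule.smul_mem _ _ hlow, ?_, (smul_inv_smul₀ hn _).symm⟩
  rintro _ ⟨h, -, rfl⟩
  have hform : X.IsForm (d + 1) (f - g) :=
    (X.formSub (d + 1)).sub_mem hf ((X.formSub (d + 1)).smul_mem _ hf.bdry.cobdry)
  have hbdry : X.bdry d (f - g) = 0 := by
    change X.bdryL d (f - g) = 0
    rw [map_sub, hg, map_smul]
    change X.bdry d f - (Fintype.card V : ℝ)⁻¹ • X.upLap d (X.bdry d f) = 0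
    rw [hskel.upLap_bdry le_rfl hf, inv_smul_smul₀ hn, sub_self]
  change innerForm (d + 1) (f - g) (X.cobdry d h) = 0
  rw [innerForm_cobdry hform, hbdry]
  simp [innerForm]
end

section
/- Let X be a finite abstract simplicial complex of dimension d on n vertices, and let τ be any (d−2)-cell of X. Then the Cheeger constants satisfy h(X) ≤ h(lk τ) / (1 − (d−1)/n), where lk τ is the link of τ (a graph) and h(lk τ) is its graph Cheeger constant. -/
open Finset

namespace SComplex

variable {V : Type} [Fintype V] [DecidableEq V]

/-- Splitting the complement of a cell `τ` with `d` vertices into `B` and `C`, and taking the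
vertices of `τ` as the remaining singleton parts, bounds the Cheeger constant. -/
theorem cheeger_le_of_split (X : SComplex V) {d : ℕ} {τ B C : Finset V} (hτ : τ.card = d)
    (hB : B.Nonempty) (hC : C.Nonempty) (hBC : Disjoint B C) (hU : B ∪ C = τᶜ) :
    X.cheeger d ≤ (Fintype.card V : ℝ) *
      (((B ×ˢ C).filter fun p => insert p.1 (insert p.2 τ) ∈ X.cells).card : ℝ) /
        ((B.card : ℝ) * (C.card : ℝ)) := by
  have hmem : ∀ v, v ∈ τ ↔ v ∉ B ∧ v ∉ C := fun v => by
    have := congrArg (v ∈ ·) hU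
    simp only [mem_union, mem_compl, eq_iff_iff] at this
    tauto
  let e : Fin d ≃ τ := (τ.equivFinOfCardEq hτ).symm
  let A : Fin (d + 2) → Finset V :=
    Fin.cons B (Fin.cons C fun i => ({(e i : V)} : Finset V))
  have hprod : ∏ i, ((A i).card : ℝ) = (B.card : ℝ) * (C.card : ℝ) := by
    simp [A, Fin.prod_univ_succ]
  have hF : X.Fcells A ⊆ ((B ×ˢ C).filter fun p => insert p.1 (insert p.2 τ) ∈ X.cells).image
      fun p => insert p.1 (insert p.2 τ) := by
    intro s hs
    simp only [Fcells, mem_filter, Fin.forall_fin_succ, A, Fin.cons_zero, Fin.cons_succ] at hs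
    obtain ⟨hsX, hcard, hsB, hsC, hsτ⟩ := hs
    obtain ⟨b, hb⟩ := card_pos.mp (hsB.symm ▸ one_pos : 0 < (s ∩ B).card)
    obtain ⟨c, hc⟩ := card_pos.mp (hsC.symm ▸ one_pos : 0 < (s ∩ C).card)
    rw [mem_inter] at hb hc
    have hτs : τ ⊆ s := by
      intro v hv
      obtain ⟨w, hw⟩ := card_pos.mp ((hsτ (e.symm ⟨v, hv⟩)).symm ▸ one_pos :
        0 < (s ∩ {(e (e.symm ⟨v, hv⟩) : V)}).card)
      simp only [Equiv.apply_symm_apply, mem_inter, mem_singleton] at hw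
      exact hw.2 ▸ hw.1
    have hbc : b ≠ c := fun h => disjoint_left.mp hBC hb.2 (h ▸ hc.2)
    have hcτ : c ∉ τ := fun h => ((hmem c).mp h).2 hc.2
    have hbτ : b ∉ insert c τ := by
      rw [mem_insert]
      rintro (h | h)
      exacts [hbc h, ((hmem b).mp h).1 hb.2]
    have hs : insert b (insert c τ) = s := by
      refine eq_of_subset_of_card_le
        (insert_subset hb.1 (insert_subset hc.1 hτs)) ?_
      rw [card_insert_of_notMem hbτ, card_insert_of_notMem hcτ, hcard, hτ]
    simp only [mem_image, mem_filter, mem_product]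
    exact ⟨(b, c), ⟨⟨hb.2, hc.2⟩, hs.symm ▸ hsX⟩, hs⟩
  have hle : ((X.Fcells A).card : ℝ) ≤
      (((B ×ˢ C).filter fun p => insert p.1 (insert p.2 τ) ∈ X.cells).card : ℝ) := by
    exact_mod_cast (card_le_card hF).trans card_image_le
  have hmin : X.cheeger d ≤
      (Fintype.card V : ℝ) * ((X.Fcells A).card : ℝ) / ∏ i, ((A i).card : ℝ) := by
    refine csInf_le ⟨0, ?_⟩ ⟨A, ?_, ?_, ?_, rfl⟩
    · rintro r ⟨A', -, -, -, rfl⟩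
      positivity
    · simp [A, Fin.forall_fin_succ, hB, hC]
    · have he : ∀ i, (e i : V) ∉ B ∧ (e i : V) ∉ C := fun i => (hmem _).mp (e i).2
      simp only [A, Fin.forall_fin_succ, Fin.cons_zero, Fin.cons_succ, disjoint_singleton_right,
        disjoint_singleton_left, ne_eq, not_true_eq_false, IsEmpty.forall_iff, Fin.succ_inj,
        Subtype.coe_inj, EmbeddingLike.apply_eq_iff_eq, mem_singleton]
      exact ⟨⟨trivial, fun _ => hBC, fun i _ => (he i).1⟩,
        ⟨fun _ => hBC.symm, trivial, fun i _ => (he i).2⟩,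
        fun i => ⟨fun _ => (he i).1, fun _ => (he i).2, fun _ h => Ne.symm h⟩⟩
    · refine eq_univ_of_forall fun v => mem_biUnion.mpr ?_
      by_cases hvB : v ∈ B
      · exact ⟨0, mem_univ _, hvB⟩
      by_cases hvC : v ∈ C
      · exact ⟨1, mem_univ _, hvC⟩
      · refine ⟨(e.symm ⟨v, (hmem v).mpr ⟨hvB, hvC⟩⟩).succ.succ, mem_univ _, ?_⟩
        simp [A]
  rw [hprod] at hmin
  exact hmin.trans (by gcongr)

/-- Two vertices outside `τ` spanning a cell together with `τ` belong to the link. -/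
theorem mem_linkVerts_of_insert_insert_mem (X : SComplex V) {τ : Finset V} {b c : V}
    (hb : b ∉ τ) (hc : c ∉ τ) (h : insert b (insert c τ) ∈ X.cells) :
    b ∈ X.linkVerts τ ∧ c ∈ X.linkVerts τ := by
  simp only [linkVerts, mem_filter, mem_univ, true_and]
  exact ⟨⟨hb, X.down_closed _ h _ (insert_subset_insert _ (subset_insert _ _))⟩,
    hc, X.down_closed _ h _ (subset_insert _ _)⟩

end SComplex

open SComplex in
/-- Proposition 4.1: for any `(d+1)`-dimensional complex `X` on `n` vertices and any
cell `τ` with `d` vertices (i.e. a `(d-1)`-dimensional cell), the Cheeger constants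
satisfy `h(X) ≤ h(lk τ)/(1 - d/n)`. -/
theorem cheeger_le_link_cheeger (V : Type) [Fintype V] [DecidableEq V] (d : ℕ)
    (X : SComplex V) (hdim : X.Dim (d + 1))
    (τ : Finset V) (hτ : τ ∈ X.cellsCard d) :
    X.cheeger d ≤ X.linkCheeger τ / (1 - (d : ℝ) / (Fintype.card V : ℝ)) := by
  have hτd : τ.card = d := (mem_filter.mp hτ).2
  have hn : d + 2 ≤ Fintype.card V := by
    obtain ⟨s, -, hs⟩ := hdim.2
    exact hs ▸ card_le_univ s
  have hnR : (d : ℝ) + 2 ≤ Fintype.card V := by exact_mod_cast hn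
  have hd0 : (0 : ℝ) ≤ d := d.cast_nonneg
  have hn0 : (0 : ℝ) < Fintype.card V := by linarith
  have hpos : 0 < 1 - (d : ℝ) / (Fintype.card V : ℝ) := by
    rw [sub_pos, div_lt_one hn0]
    linarith
  rw [le_div_iff₀ hpos]
  by_cases hlink : ∃ b ∈ X.linkVerts τ, ∃ c ∈ X.linkVerts τ, b ≠ c
  · obtain ⟨b, hb, c, hc, hbc⟩ := hlink
    refine le_csInf ⟨_, {b}, (X.linkVerts τ).erase b, singleton_nonempty b,
      ⟨c, mem_erase.mpr ⟨hbc.symm, hc⟩⟩, by simp, ?_, rfl⟩ ?_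
    · rw [← insert_eq, insert_erase hb]
    rintro r ⟨B, C, hB, hC, hBC, hU, rfl⟩
    have hWτ : X.linkVerts τ ⊆ τᶜ := fun v hv =>
      mem_compl.mpr (mem_filter.mp hv).2.1
    have hBτ : B ⊆ τᶜ := (subset_union_left.trans hU.subset).trans hWτ
    have hCD : C ⊆ τᶜ \ B := fun v hv => mem_sdiff.mpr
      ⟨hWτ (hU ▸ mem_union_right _ hv), disjoint_right.mp hBC hv⟩
    have hbound := X.cheeger_le_of_split hτd hB (hC.mono hCD) disjoint_sdiff
      (union_sdiff_of_subset hBτ)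
    have hE : ((B ×ˢ (τᶜ \ B)).filter fun p => insert p.1 (insert p.2 τ) ∈ X.cells) =
        (B ×ˢ C).filter fun p => insert p.1 (insert p.2 τ) ∈ X.cells := by
      ext ⟨b, c⟩
      simp only [mem_filter, mem_product]
      refine ⟨fun ⟨⟨hb, hc⟩, h⟩ => ⟨⟨hb, ?_⟩, h⟩, fun ⟨⟨hb, hc⟩, h⟩ => ⟨⟨hb, hCD hc⟩, h⟩⟩
      have hcW := (X.mem_linkVerts_of_insert_insert_mem (mem_compl.mp (hBτ hb))
        (mem_compl.mp (mem_sdiff.mp hc).1) h).2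
      exact (mem_union.mp (hU.symm ▸ hcW)).resolve_left (mem_sdiff.mp hc).2
    have hW : ((X.linkVerts τ).card : ℝ) = B.card + C.card := by
      rw [← hU, card_union_of_disjoint hBC, Nat.cast_add]
    have hV : (Fintype.card V : ℝ) - d = B.card + (τᶜ \ B).card := by
      have h₁ := card_sdiff_add_card_eq_card hBτ
      have h₂ := card_add_card_compl τ
      rw [sub_eq_iff_eq_add]
      norm_cast
      omega
    have hle : (C.card : ℝ) ≤ (τᶜ \ B).card := by exact_mod_cast card_le_card hCD
    have hB0 : (0 : ℝ) < B.card := by exact_mod_cast hB.card_pos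
    have hC0 : (0 : ℝ) < C.card := by exact_mod_cast hC.card_pos
    rw [hE] at hbound
    rw [hW]
    refine (mul_le_mul_of_nonneg_right hbound hpos.le).trans ?_
    rw [one_sub_div hn0.ne', hV]
    have hD0 : (0 : ℝ) < (τᶜ \ B).card := hC0.trans_le hle
    rw [div_mul_div_comm, div_le_div_iff₀ (by positivity) (by positivity)]
    have hE0 := Nat.cast_nonneg (α := ℝ)
      ((B ×ˢ C).filter fun p => insert p.1 (insert p.2 τ) ∈ X.cells).card
    have key := mul_le_mul_of_nonneg_left hle
      (mul_nonneg (mul_nonneg (mul_nonneg hn0.le hE0) hB0.le) hB0.le)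
    linarith
  · have hcompl : 1 < (τᶜ).card := by
      rw [card_compl]
      omega
    obtain ⟨b, hb, c, hc, hbc⟩ := one_lt_card.mp hcompl
    have hbound := X.cheeger_le_of_split (B := {b}) (C := τᶜ.erase b) hτd
      (singleton_nonempty b) ⟨c, mem_erase.mpr ⟨hbc.symm, hc⟩⟩ (by simp)
      (by rw [← insert_eq, insert_erase hb])
    rw [filter_false_of_mem] at hbound
    · rw [card_empty, Nat.cast_zero, mul_zero, zero_div] at hbound
      refine (mul_nonpos_of_nonpos_of_nonneg hbound hpos.le).trans (Real.sInf_nonneg ?_)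
      rintro r ⟨B, C, -, -, -, -, rfl⟩
      positivity
    · rintro ⟨v, w⟩ hvw h
      simp only [mem_product, mem_singleton, mem_erase] at hvw
      obtain ⟨rfl, hne, hw⟩ := hvw
      obtain ⟨hv', hw'⟩ := X.mem_linkVerts_of_insert_insert_mem (mem_compl.mp hb)
        (mem_compl.mp hw) h
      exact hlink ⟨v, hv', w, hw', hne.symm⟩
end
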